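/- arXiv:0806.0435 — 2 statements merged into one kernel-verified Lean document; each statement's English description precedes it below -/
import Mathlib

section
/- Define rational numbers a_{k,i} for k ≥ 0 and 0 ≤ i ≤ k by a_{0,0} = 1/2 and, for k ≥ 0: a_{k+1,i} = (k+1)(k+2)·((k+2−i)/i)·a_{k,i−1} for 1 ≤ i ≤ k+1, and a_{k+1,0} = Σ_{j=1}^{k+1} (−1)^{j+1} a_{k+1,j}. Then for every k ≥ 0 and every n ≥ max{3, 2k} with CP_n([n−k+1, n]) ≠ ∅, cp_n([n−k+1, n]) = Σ_{i=0}^{k} (−1)^{i} a_{k,i}·(2k+2−2i)^{n−2k}. -/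
/-- The permutation σ of `Fin n` viewed as a word on `[n] = {1,…,n}`:
position `j` (0-indexed) carries the letter `σ(j)+1`; out-of-range positions give `0`. -/
def permToFun (n : ℕ) (σ : Equiv.Perm (Fin n)) : ℕ → ℕ :=
  fun j => if h : j < n then ((σ ⟨j, h⟩ : ℕ) + 1) else 0

/-- The circular peak set `CP(σ) = {σ(i) | σ(i-1) < σ(i) > σ(i+1)}` of a
permutation of `[n]`, as a `Finset ℕ` of values in `{1,…,n}`. -/
def circularPeakSet (n : ℕ) (σ : Equiv.Perm (Fin n)) : Finset ℕ :=
  ((Finset.Ioo 0 (n - 1)).filter (fun j =>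
    permToFun n σ (j - 1) < permToFun n σ j ∧
    permToFun n σ (j + 1) < permToFun n σ j)).image (permToFun n σ)

/-- `CPperms n S` is the set `CP_n(S)` of permutations of `[n]` with circular peak set `S`. -/
def CPperms (n : ℕ) (S : Finset ℕ) : Finset (Equiv.Perm (Fin n)) :=
  Finset.univ.filter (fun σ => circularPeakSet n σ = S)

/-- `cp n S = |CP_n(S)|`. -/
def cp (n : ℕ) (S : Finset ℕ) : ℕ := (CPperms n S).card


/-! ### Counting -/

def cCnt : ℕ → ℕ → ℕ
  | 0, 0 => 1
  | 0, _ + 1 => 0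
  | _ + 1, 0 => 0
  | m + 1, j + 1 => 2 * (j + 1) * cCnt m (j + 1) + (j + 1) * cCnt m j

def Nrm {m K : ℕ} (h : Fin m → Fin K × Bool) : Prop :=
  ∀ v, (h v).2 = true → ∃ u, u < v ∧ (h u).1 = (h v).1

def Img {m K : ℕ} (h : Fin m → Fin K × Bool) : Finset (Fin K) :=
  Finset.univ.image (fun v => (h v).1)

lemma img_snoc {m K : ℕ} (h : Fin m → Fin K × Bool) (x : Fin K × Bool) :
    Img (Fin.snoc (α := fun _ => Fin K × Bool) h x) = insert x.1 (Img h) := by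
  ext b
  simp only [Img, Finset.mem_image, Finset.mem_univ, true_and, Finset.mem_insert]
  constructor
  · rintro ⟨v, rfl⟩
    induction v using Fin.lastCases with
    | last => left; simp
    | cast v => right; exact ⟨v, by simp⟩
  · rintro (rfl | ⟨v, rfl⟩)
    · exact ⟨Fin.last m, by simp⟩
    · exact ⟨v.castSucc, by simp⟩

lemma nrm_snoc {m K : ℕ} (h : Fin m → Fin K × Bool) (x : Fin K × Bool) :
    Nrm (Fin.snoc (α := fun _ => Fin K × Bool) h x) ↔
      Nrm h ∧ (x.2 = true → x.1 ∈ Img h) := by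
  simp only [Img, Finset.mem_image, Finset.mem_univ, true_and]
  constructor
  · intro H
    refine ⟨fun v hv => ?_, fun hx => ?_⟩
    · obtain ⟨u, hu, e⟩ := H v.castSucc (by simpa using hv)
      induction u using Fin.lastCases with
      | last => exact absurd hu (not_lt_of_gt (Fin.castSucc_lt_last v))
      | cast u => exact ⟨u, by simpa using hu, by simpa using e⟩
    · obtain ⟨u, hu, e⟩ := H (Fin.last m) (by simpa using hx)
      induction u using Fin.lastCases with
      | last => exact absurd hu (lt_irrefl _)
      | cast u => exact ⟨u, by simpa using e⟩
  · rintro ⟨H, hx⟩ v hv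
    induction v using Fin.lastCases with
    | last =>
      obtain ⟨u, e⟩ := hx (by simpa using hv)
      exact ⟨u.castSucc, Fin.castSucc_lt_last u, by simpa using e⟩
    | cast v =>
      obtain ⟨u, hu, e⟩ := H v (by simpa using hv)
      exact ⟨u.castSucc, by simpa using hu, by simpa using e⟩

open Classical in
noncomputable def GG (m K : ℕ) (S : Finset (Fin K)) : ℕ :=
  (Finset.univ.filter (fun h : Fin m → Fin K × Bool => Nrm h ∧ Img h = S)).card

open Classical in
lemma GG_succ (m K : ℕ) (S : Finset (Fin K)) :
    GG (m+1) K S = 2 * S.card * GG m K S + ∑ b ∈ S, GG m K (S.erase b) := by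
  have e : GG (m+1) K S = ∑ x : Fin K × Bool, (Finset.univ.filter
      (fun h : Fin m → Fin K × Bool => (Nrm h ∧ (x.2 = true → x.1 ∈ Img h)) ∧
        insert x.1 (Img h) = S)).card := by
    unfold GG
    rw [← Finset.card_sigma]
    symm
    refine Finset.card_bij (fun p _ => Fin.snoc (α := fun _ => Fin K × Bool) p.2 p.1) ?_ ?_ ?_
    · rintro ⟨x, h⟩ hh
      simp only [Finset.mem_sigma, Finset.mem_univ, true_and, Finset.mem_filter] at hh ⊢
      rw [nrm_snoc, img_snoc]; exact hh
    · rintro ⟨x, h⟩ _ ⟨x', h'⟩ _ hh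
      have := Fin.snoc_injective2 (α := fun _ => Fin K × Bool) hh
      simp only at this
      rw [this.1, this.2]
    · intro g hg
      simp only [Finset.mem_univ, true_and, Finset.mem_filter] at hg
      refine ⟨⟨g (Fin.last m), Fin.init g⟩, ?_, by simp⟩
      simp only [Finset.mem_sigma, Finset.mem_univ, true_and, Finset.mem_filter]
      rw [← nrm_snoc, ← img_snoc]
      simpa using hg
  rw [e, Fintype.sum_prod_type]
  have key : ∀ b : Fin K, (∑ s : Bool, (Finset.univ.filter
      (fun h : Fin m → Fin K × Bool => (Nrm h ∧ (s = true → b ∈ Img h)) ∧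
        insert b (Img h) = S)).card) =
      if b ∈ S then 2 * GG m K S + GG m K (S.erase b) else 0 := by
    intro b
    rw [Fintype.sum_bool]
    by_cases hb : b ∈ S
    · rw [if_pos hb]
      have h1 : (Finset.univ.filter
        (fun h : Fin m → Fin K × Bool => (Nrm h ∧ (true = true → b ∈ Img h)) ∧
          insert b (Img h) = S)).card = GG m K S := by
        unfold GG
        congr 1
        ext h
        simp only [Finset.mem_filter, Finset.mem_univ, true_and, forall_const]
        constructor
        · rintro ⟨⟨a, c⟩, d⟩
          rw [Finset.insert_eq_of_mem c] at d
          exact ⟨a, d⟩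
        · rintro ⟨a, rfl⟩
          exact ⟨⟨a, hb⟩, Finset.insert_eq_of_mem hb⟩
      have h2 : (Finset.univ.filter
        (fun h : Fin m → Fin K × Bool => (Nrm h ∧ (false = true → b ∈ Img h)) ∧
          insert b (Img h) = S)).card = GG m K S + GG m K (S.erase b) := by
        unfold GG
        rw [← Finset.card_union_of_disjoint]
        · congr 1
          ext h
          simp only [Finset.mem_filter, Finset.mem_univ, true_and, Finset.mem_union]
          constructor
          · rintro ⟨⟨a, c⟩, d⟩
            by_cases hc : b ∈ Img h
            · rw [Finset.insert_eq_of_mem hc] at d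
              exact Or.inl ⟨a, d⟩
            · right
              exact ⟨a, by rw [← d, Finset.erase_insert hc]⟩
          · rintro (⟨a, d⟩ | ⟨a, d⟩)
            · exact ⟨⟨a, by simp⟩, by rw [d]; exact Finset.insert_eq_of_mem hb⟩
            · exact ⟨⟨a, by simp⟩, by rw [d]; exact Finset.insert_erase hb⟩
        · rw [Finset.disjoint_left]
          intro h h1 h2
          simp only [Finset.mem_filter, Finset.mem_univ, true_and] at h1 h2
          have := h1.2.symm.trans h2.2
          rw [this] at hb
          simp at hb
      refine (congrArg₂ (· + ·) h1 h2).trans ?_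
      ring
    · rw [if_neg hb, Finset.filter_false_of_mem, Finset.filter_false_of_mem]
      · simp
      · rintro h - ⟨-, d⟩
        exact hb (d ▸ Finset.mem_insert_self _ _)
      · rintro h - ⟨-, d⟩
        exact hb (d ▸ Finset.mem_insert_self _ _)
  rw [Finset.sum_congr rfl (fun b _ => key b), Finset.sum_ite_mem, Finset.univ_inter,
    Finset.sum_add_distrib, Finset.sum_const, smul_eq_mul]
  ring

lemma GG_eq (K : ℕ) : ∀ (m : ℕ) (S : Finset (Fin K)), GG m K S = cCnt m S.card := by
  intro m
  induction m with
  | zero =>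
    classical
    intro S
    unfold GG
    by_cases hS : S = ∅
    · subst hS
      rw [Finset.filter_true_of_mem]
      · simp [cCnt]
      · intro h _
        exact ⟨fun v => v.elim0, by simp [Img]⟩
    · rw [Finset.filter_false_of_mem]
      · obtain ⟨j, hj⟩ := Nat.exists_eq_succ_of_ne_zero
          (fun h => hS (Finset.card_eq_zero.1 h))
        rw [hj]; simp [cCnt]
      · rintro h - ⟨-, d⟩
        exact hS (by rw [← d]; simp [Img])
  | succ m ih =>
    intro S
    rw [GG_succ, ih]
    have : ∀ b ∈ S, GG m K (S.erase b) = cCnt m (S.card - 1) := by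
      intro b hb
      rw [ih, Finset.card_erase_of_mem hb]
    rw [Finset.sum_congr rfl this, Finset.sum_const, smul_eq_mul]
    rcases S.card with _ | j
    · simp [cCnt]
    · simp [cCnt]

lemma cCnt_zero_of_lt : ∀ (m j : ℕ), m < j → cCnt m j = 0 := by
  intro m
  induction m with
  | zero => intro j hj; obtain ⟨j, rfl⟩ := Nat.exists_eq_succ_of_ne_zero (by omega : j ≠ 0); rfl
  | succ m ih =>
    intro j hj
    obtain ⟨j, rfl⟩ := Nat.exists_eq_succ_of_ne_zero (by omega : j ≠ 0)
    simp [cCnt, ih (j+1) (by omega), ih j (by omega)]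

lemma cCnt_one (t : ℕ) : cCnt (t+1) 1 = 2 ^ t := by
  induction t with
  | zero => simp [cCnt]
  | succ t ih => rw [cCnt, ih]; simp [cCnt]; ring

lemma algebra_part (a : ℕ → ℕ → ℚ) (ha0 : a 0 0 = 1 / 2)
    (harec1 : ∀ k, ∀ i, 1 ≤ i → i ≤ k + 1 →
      a (k + 1) i = ((k : ℚ) + 1) * ((k : ℚ) + 2) * (((k : ℚ) + 2 - (i : ℚ)) / (i : ℚ)) *
        a k (i - 1))
    (harec0 : ∀ k, a (k + 1) 0 = ∑ j ∈ Finset.Icc 1 (k + 1), (-1) ^ (j + 1) * a (k + 1) j) :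
    ∀ k t : ℕ, 1 ≤ k + t → ((k.factorial * cCnt (k + t) (k+1) : ℕ) : ℚ) =
        ∑ i ∈ Finset.range (k + 1), (-1) ^ i * a k i *
          (2 * (k : ℚ) + 2 - 2 * (i : ℚ)) ^ t := by
  intro k
  induction k with
  | zero =>
    intro t ht
    obtain ⟨t, rfl⟩ := Nat.exists_eq_succ_of_ne_zero (by omega : t ≠ 0)
    rw [Nat.succ_eq_add_one, zero_add, cCnt_one]
    simp [ha0]
    ring
  | succ k ihk =>
    have ha1 : ∀ i ∈ Finset.range (k+1), a (k+1) (i+1) =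
        ((k:ℚ)+1) * (k+2) * ((k+1-i) / (i+1)) * a k i := by
      intro i hi
      rw [harec1 k (i+1) (by omega) (by simp at hi; omega)]
      push_cast
      ring
    intro t
    induction t with
    | zero =>
      intro _
      rw [cCnt_zero_of_lt _ _ (by omega), Finset.sum_range_succ', harec0]
      rw [← Finset.sum_Ico_add_eq_sum_Icc, Finset.sum_Ico_eq_sum_range] <;> try omega
      have : ∀ f : ℕ → ℚ, ∑ i ∈ Finset.range (k+1), f i = ∑ i ∈ Finset.range k, f i + f k :=
        fun f => Finset.sum_range_succ _ _
      rw [this]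
      simp [pow_succ, add_comm 1]
      ring
    | succ t iht =>
      intro _
      have e1 := iht (by omega)
      have e2 := ihk (t+1) (by omega)
      have e3 : k + 1 + (t + 1) = (k + (t+1)) + 1 := by ring
      have e4 : k + 1 + t = k + (t+1) := by ring
      rw [e4] at e1
      have : ((k+1).factorial * cCnt (k + 1 + (t + 1)) (k+1+1) : ℕ) =
        2 * (k+2) * ((k+1).factorial * cCnt (k + (t+1)) (k+1+1)) +
          (k+1) * (k+2) * (k.factorial * cCnt (k + (t+1)) (k+1)) := by
        rw [e3, cCnt, Nat.factorial_succ]; ring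
      rw [this]
      push_cast at e1 e2 ⊢
      rw [e1, e2]
      rw [Finset.sum_range_succ', Finset.sum_range_succ' _ (k+1), mul_add, Finset.mul_sum,
        Finset.mul_sum]
      rw [add_right_comm, ← Finset.sum_add_distrib]
      congr 1
      · refine Finset.sum_congr rfl fun i hi => ?_
        rw [ha1 i hi]
        have : (i:ℚ) + 1 ≠ 0 := by positivity
        push_cast
        field_simp
        ring
      · push_cast; ring

/-! ### The bijection -/

def kkey {m k : ℕ} (π : Equiv.Perm (Fin k)) (h : Fin m → Fin (k+1) × Bool) :
    Fin (m + k) → ℤ ×ₗ ℤ :=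
  Fin.addCases (motive := fun _ => ℤ ×ₗ ℤ)
    (fun v => toLex (2 * ((h v).1.val : ℤ), if (h v).2 then (v.val : ℤ) + 1 else -((v.val : ℤ) + 1)))
    (fun w => toLex (2 * ((π w).val : ℤ) + 1, 0))

lemma kkey_small {m k : ℕ} (π : Equiv.Perm (Fin k)) (h : Fin m → Fin (k+1) × Bool) (v : Fin m) :
    kkey π h (Fin.castAdd k v) =
      toLex (2 * ((h v).1.val : ℤ), if (h v).2 then (v.val : ℤ) + 1 else -((v.val : ℤ) + 1)) := by
  simp [kkey]

lemma kkey_big {m k : ℕ} (π : Equiv.Perm (Fin k)) (h : Fin m → Fin (k+1) × Bool) (w : Fin k) :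
    kkey π h (Fin.natAdd m w) = toLex (2 * ((π w).val : ℤ) + 1, 0) := by
  simp [kkey]

lemma kkey_inj {m k : ℕ} (π : Equiv.Perm (Fin k)) (h : Fin m → Fin (k+1) × Bool) :
    Function.Injective (kkey π h) := by
  intro x y
  induction x using Fin.addCases with
  | left u =>
    induction y using Fin.addCases with
    | left v =>
      rw [kkey_small, kkey_small]
      intro e
      have e := toLex.injective e
      simp only [Prod.mk.injEq] at e
      congr 1
      apply Fin.ext
      have := e.2
      split_ifs at this <;> omega
    | right w =>
      rw [kkey_small, kkey_big]
      intro e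
      have e := toLex.injective e
      simp only [Prod.mk.injEq] at e
      omega
  | right u =>
    induction y using Fin.addCases with
    | left v =>
      rw [kkey_small, kkey_big]
      intro e
      have e := toLex.injective e
      simp only [Prod.mk.injEq] at e
      omega
    | right w =>
      rw [kkey_big, kkey_big]
      intro e
      have e := toLex.injective e
      simp only [Prod.mk.injEq] at e
      congr 1
      apply π.injective
      apply Fin.ext
      omega

def Vld (m k : ℕ) (σ : Equiv.Perm (Fin (m + k))) : Prop :=
  (∀ w : Fin k, ∃ j, ∃ h : j + 2 < m + k, σ ⟨j+1, by omega⟩ = Fin.natAdd m w ∧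
    σ ⟨j, by omega⟩ < σ ⟨j+1, by omega⟩ ∧ σ ⟨j+2, h⟩ < σ ⟨j+1, by omega⟩) ∧
  (∀ j, ∀ h : j + 2 < m + k, σ ⟨j, by omega⟩ < σ ⟨j+1, by omega⟩ →
    σ ⟨j+2, h⟩ < σ ⟨j+1, by omega⟩ → m ≤ (σ ⟨j+1, by omega⟩).val)

lemma mem_cps (n : ℕ) (σ : Equiv.Perm (Fin n)) (x : ℕ) :
    x ∈ circularPeakSet n σ ↔ ∃ j, ∃ h : j + 2 < n, σ ⟨j, by omega⟩ < σ ⟨j+1, by omega⟩ ∧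
      σ ⟨j+2, h⟩ < σ ⟨j+1, by omega⟩ ∧ (σ ⟨j+1, by omega⟩).val + 1 = x := by
  simp only [circularPeakSet, Finset.mem_image, Finset.mem_filter, Finset.mem_Ioo]
  constructor
  · rintro ⟨j, ⟨⟨h0, h1⟩, h2, h3⟩, h4⟩
    obtain ⟨j, rfl⟩ := Nat.exists_eq_succ_of_ne_zero (by omega : j ≠ 0)
    have hn : j + 2 < n := by omega
    simp only [Nat.succ_eq_add_one, Nat.add_sub_cancel, permToFun, dif_pos hn,
      dif_pos (by omega : j + 1 < n), dif_pos (by omega : j < n), add_assoc, Nat.reduceAdd] at h2 h3 h4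
    refine ⟨j, hn, ?_, ?_, h4⟩
    · rw [Fin.lt_def]; omega
    · rw [Fin.lt_def]; omega
  · rintro ⟨j, h, h1, h2, h3⟩
    rw [Fin.lt_def] at h1 h2
    refine ⟨j + 1, ⟨⟨by omega, by omega⟩, ?_⟩, ?_⟩
    · simp only [Nat.add_sub_cancel, permToFun, dif_pos h,
        dif_pos (by omega : j + 1 < n), dif_pos (by omega : j < n), add_assoc, Nat.reduceAdd]
      omega
    · simp only [permToFun, dif_pos (by omega : j + 1 < n)]
      omega

lemma vld_iff (m k : ℕ) (σ : Equiv.Perm (Fin (m + k))) :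
    circularPeakSet (m + k) σ = Finset.Icc (m + 1) (m + k) ↔ Vld m k σ := by
  rw [Finset.ext_iff]
  simp only [mem_cps, Finset.mem_Icc]
  constructor
  · intro H
    constructor
    · intro w
      obtain ⟨j, h, h1, h2, h3⟩ := (H (m + w.val + 1)).2 (by omega)
      refine ⟨j, h, ?_, h1, h2⟩
      apply Fin.ext
      simp only [Fin.val_natAdd]
      omega
    · intro j h h1 h2
      have := (H _).1 ⟨j, h, h1, h2, rfl⟩
      omega
  · rintro ⟨H1, H2⟩ x
    constructor
    · rintro ⟨j, h, h1, h2, h3⟩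
      have := H2 j h h1 h2
      omega
    · rintro ⟨h1, h2⟩
      obtain ⟨j, h, e, h3, h4⟩ := H1 ⟨x - (m + 1), by omega⟩
      refine ⟨j, h, h3, h4, ?_⟩
      rw [e]
      simp only [Fin.val_natAdd]
      omega

lemma sort_exists {m k : ℕ} (π : Equiv.Perm (Fin k)) (h : Fin m → Fin (k+1) × Bool) :
    ∃ σ : Equiv.Perm (Fin (m + k)), StrictMono (kkey π h ∘ σ) :=
  ⟨Tuple.sort (kkey π h), (Tuple.monotone_sort _).strictMono_of_injective
    ((kkey_inj π h).comp (Equiv.injective _))⟩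

lemma before_iff {m k : ℕ} {π : Equiv.Perm (Fin k)} {h : Fin m → Fin (k+1) × Bool}
    {σ : Equiv.Perm (Fin (m + k))} (hs : StrictMono (kkey π h ∘ σ)) (x y : Fin (m + k)) :
    kkey π h x < kkey π h y ↔ σ.symm x < σ.symm y := by
  rw [← hs.lt_iff_lt]; simp

lemma small_lt_big {m k : ℕ} (π : Equiv.Perm (Fin k)) (h : Fin m → Fin (k+1) × Bool)
    (v : Fin m) (w : Fin k) :
    kkey π h (Fin.castAdd k v) < kkey π h (Fin.natAdd m w) ↔ (h v).1.val ≤ (π w).val := by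
  rw [kkey_small, kkey_big, Prod.Lex.toLex_lt_toLex]
  simp only
  omega

lemma big_lt_small {m k : ℕ} (π : Equiv.Perm (Fin k)) (h : Fin m → Fin (k+1) × Bool)
    (v : Fin m) (w : Fin k) :
    kkey π h (Fin.natAdd m w) < kkey π h (Fin.castAdd k v) ↔ (π w).val < (h v).1.val := by
  rw [kkey_small, kkey_big, Prod.Lex.toLex_lt_toLex]
  simp only
  omega

lemma big_lt_big {m k : ℕ} (π : Equiv.Perm (Fin k)) (h : Fin m → Fin (k+1) × Bool)
    (w w' : Fin k) :
    kkey π h (Fin.natAdd m w) < kkey π h (Fin.natAdd m w') ↔ π w < π w' := by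
  rw [kkey_big, kkey_big, Prod.Lex.toLex_lt_toLex, Fin.lt_def]
  simp only
  omega

lemma small_lt_small {m k : ℕ} (π : Equiv.Perm (Fin k)) (h : Fin m → Fin (k+1) × Bool)
    (u v : Fin m) :
    kkey π h (Fin.castAdd k u) < kkey π h (Fin.castAdd k v) ↔
      ((h u).1.val < (h v).1.val ∨ (h u).1 = (h v).1 ∧
        (((h u).2 = false ∧ (h v).2 = true) ∨ (u < v ∧ (h v).2 = true) ∨
          (v < u ∧ (h u).2 = false))) := by
  rw [kkey_small, kkey_small, Prod.Lex.toLex_lt_toLex, Fin.lt_def, Fin.lt_def, Fin.ext_iff]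
  simp only
  cases (h u).2 <;> cases (h v).2 <;> simp <;> omega

lemma data_unique {m k : ℕ} {π π' : Equiv.Perm (Fin k)} {h h' : Fin m → Fin (k+1) × Bool}
    {σ : Equiv.Perm (Fin (m + k))} (hs : StrictMono (kkey π h ∘ σ))
    (hs' : StrictMono (kkey π' h' ∘ σ)) (hN : Nrm h) (hN' : Nrm h') : π = π' ∧ h = h' := by
  have H : ∀ x y, kkey π h x < kkey π h y ↔ kkey π' h' x < kkey π' h' y := fun x y => by
    rw [before_iff hs, before_iff hs']
  have hπ : π = π' := by
    have h1 : StrictMono (π'.symm.trans π) := by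
      intro x y hxy
      have := (H (Fin.natAdd m (π'.symm x)) (Fin.natAdd m (π'.symm y)))
      rw [big_lt_big, big_lt_big] at this
      simpa using this.2 (by simpa using hxy)
    have h2 : ∀ x, (π'.symm.trans π) x = x := by
      intro x
      have h3 : (h1.orderIsoOfSurjective _ (Equiv.surjective _)) = OrderIso.refl _ :=
        Subsingleton.elim _ _
      have := congrArg (fun f => f x) h3
      simpa using this
    ext w
    have := h2 (π' w)
    simp at this
    rw [this]
  subst hπ
  refine ⟨rfl, ?_⟩
  have hb : ∀ v, (h v).1 = (h' v).1 := by
    intro v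
    have h1 : ∀ j : Fin k, (h v).1.val ≤ j ↔ (h' v).1.val ≤ j := by
      intro j
      have := H (Fin.castAdd k v) (Fin.natAdd m (π.symm j))
      rw [small_lt_big, small_lt_big] at this
      simpa using this
    apply Fin.ext
    rcases lt_trichotomy (h v).1.val (h' v).1.val with hl | hl | hl
    · have := h1 ⟨(h v).1.val, by omega⟩
      simp only at this; omega
    · exact hl
    · have := h1 ⟨(h' v).1.val, by omega⟩
      simp only at this; omega
  have aux : ∀ v, (h v).2 = true → (h' v).2 = true := by
    intro v hv
    obtain ⟨u, hu, e⟩ := hN v hv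
    have := (H (Fin.castAdd k u) (Fin.castAdd k v)).1
      ((small_lt_small _ _ _ _).2 (Or.inr ⟨e, Or.inr (Or.inl ⟨hu, hv⟩)⟩))
    rw [small_lt_small, ← hb, ← hb, e] at this
    simp only [lt_irrefl, false_or, true_and] at this
    rcases this with h | h | h
    · exact h.2
    · exact h.2
    · exact absurd hu (not_lt_of_gt h.1)
  have aux' : ∀ v, (h' v).2 = true → (h v).2 = true := by
    intro v hv
    obtain ⟨u, hu, e⟩ := hN' v hv
    have := (H (Fin.castAdd k u) (Fin.castAdd k v)).2
      ((small_lt_small _ _ _ _).2 (Or.inr ⟨e, Or.inr (Or.inl ⟨hu, hv⟩)⟩))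
    rw [small_lt_small, hb, hb, e] at this
    simp only [lt_irrefl, false_or, true_and] at this
    rcases this with h | h | h
    · exact h.2
    · exact h.2
    · exact absurd hu (not_lt_of_gt h.1)
  funext v
  exact Prod.ext (hb v) (Bool.eq_iff_iff.2 ⟨aux v, aux' v⟩)

lemma no_between {m k : ℕ} {π : Equiv.Perm (Fin k)} {h : Fin m → Fin (k+1) × Bool}
    {σ : Equiv.Perm (Fin (m + k))} (hs : StrictMono (kkey π h ∘ σ)) (j : ℕ) (hj : j + 1 < m + k)
    (x : Fin (m + k)) (h1 : kkey π h (σ ⟨j, by omega⟩) < kkey π h x)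
    (h2 : kkey π h x < kkey π h (σ ⟨j+1, hj⟩)) : False := by
  rw [before_iff hs, Equiv.symm_apply_apply, Fin.lt_def] at h1 h2
  simp only at h1 h2
  omega

lemma step_lt {m k : ℕ} {π : Equiv.Perm (Fin k)} {h : Fin m → Fin (k+1) × Bool}
    {σ : Equiv.Perm (Fin (m + k))} (hs : StrictMono (kkey π h ∘ σ)) (j : ℕ) (hj : j + 1 < m + k) :
    kkey π h (σ ⟨j, by omega⟩) < kkey π h (σ ⟨j+1, hj⟩) :=
  hs (by simp [Fin.lt_def])

lemma small_or_big {m k : ℕ} (x : Fin (m + k)) :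
    (∃ v, x = Fin.castAdd k v) ∨ (∃ w, x = Fin.natAdd m w) := by
  induction x using Fin.addCases with
  | left v => exact Or.inl ⟨v, rfl⟩
  | right w => exact Or.inr ⟨w, rfl⟩

lemma img_univ {m K : ℕ} {h : Fin m → Fin K × Bool} (hS : Img h = Finset.univ) (b : Fin K) :
    ∃ v, (h v).1 = b := by
  have : b ∈ Img h := by rw [hS]; exact Finset.mem_univ _
  simpa [Img] using this

lemma sort_valid {m k : ℕ} {π : Equiv.Perm (Fin k)} {h : Fin m → Fin (k+1) × Bool}
    {σ : Equiv.Perm (Fin (m + k))} (hs : StrictMono (kkey π h ∘ σ)) 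
    (hS : Img h = Finset.univ) : Vld m k σ := by
  constructor
  · intro w
    obtain ⟨u, hu⟩ := img_univ hS (π w).castSucc
    obtain ⟨v, hv⟩ := img_univ hS (π w).succ
    have h1 : kkey π h (Fin.castAdd k u) < kkey π h (Fin.natAdd m w) := by
      rw [small_lt_big, hu]; simp
    have h2 : kkey π h (Fin.natAdd m w) < kkey π h (Fin.castAdd k v) := by
      rw [big_lt_small, hv]; simp
    have h1' := (before_iff hs _ _).1 h1
    have h2' := (before_iff hs _ _).1 h2
    obtain ⟨p, hp⟩ : ∃ p, p = σ.symm (Fin.natAdd m w) := ⟨_, rfl⟩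
    rw [← hp, Fin.lt_def] at h1' h2'
    have hpw : σ p = Fin.natAdd m w := by rw [hp]; simp
    obtain ⟨p, hpl⟩ := p
    simp only at h1' h2'
    obtain ⟨j, rfl⟩ := Nat.exists_eq_succ_of_ne_zero (by omega : p ≠ 0)
    have hj2 : j + 2 < m + k := by omega
    simp only [Nat.succ_eq_add_one] at hpw
    refine ⟨j, hj2, hpw, ?_, ?_⟩
    · rw [hpw]
      rcases small_or_big (σ ⟨j, by omega⟩) with ⟨x, hx⟩ | ⟨x, hx⟩
      · rw [hx, Fin.lt_def]; simp; omega
      · exfalso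
        have h3 := step_lt hs j (by omega)
        rw [hx, hpw, big_lt_big] at h3
        refine no_between hs j (by omega) (Fin.castAdd k u) ?_ ?_
        · rw [hx, big_lt_small, hu]; simpa using h3
        · rw [hpw]; exact h1
    · rw [hpw]
      rcases small_or_big (σ ⟨j+2, by omega⟩) with ⟨x, hx⟩ | ⟨x, hx⟩
      · rw [hx, Fin.lt_def]; simp; omega
      · exfalso
        have h3 := step_lt hs (j+1) (by omega)
        simp only [add_assoc, Nat.reduceAdd] at h3
        rw [hx, hpw, big_lt_big] at h3
        refine no_between hs (j+1) (by omega) (Fin.castAdd k v) ?_ ?_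
        · rw [hpw]; exact h2
        · simp only [add_assoc, Nat.reduceAdd]
          rw [hx, small_lt_big, hv]; simpa using h3
  · intro j hj h1 h2
    rcases small_or_big (σ ⟨j+1, by omega⟩) with ⟨x, hx⟩ | ⟨x, hx⟩
    · exfalso
      rw [hx] at h1 h2
      rw [Fin.lt_def, Fin.val_castAdd] at h1 h2
      rcases small_or_big (σ ⟨j, by omega⟩) with ⟨u, hu⟩ | ⟨u, hu⟩
      swap
      · rw [hu, Fin.val_natAdd] at h1; omega
      rcases small_or_big (σ ⟨j+2, by omega⟩) with ⟨v, hv⟩ | ⟨v, hv⟩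
      swap
      · rw [hv, Fin.val_natAdd] at h2; omega
      rw [hu, Fin.val_castAdd] at h1
      rw [hv, Fin.val_castAdd] at h2
      have s1 := step_lt hs j (by omega)
      have s2 := step_lt hs (j+1) (by omega)
      simp only [add_assoc, Nat.reduceAdd] at s2
      rw [hu, hx, small_lt_small] at s1
      rw [hv, hx, small_lt_small] at s2
      have b1 : ¬ (h u).1.val < (h x).1.val := by
        intro hl
        refine no_between hs j (by omega) (Fin.natAdd m (π.symm ⟨(h u).1.val, by omega⟩)) ?_ ?_
        · rw [hu, small_lt_big]; simp
        · rw [hx, big_lt_small]; simpa using hl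
      have b2 : ¬ (h x).1.val < (h v).1.val := by
        intro hl
        refine no_between hs (j+1) (by omega) (Fin.natAdd m (π.symm ⟨(h x).1.val, by omega⟩)) ?_ ?_
        · rw [hx, small_lt_big]; simp
        · simp only [add_assoc, Nat.reduceAdd]
          rw [hv, big_lt_small]; simpa using hl
      simp only [b1, b2, false_or, Fin.lt_def] at s1 s2
      cases hxs : (h x).2 <;> simp [hxs] at s1 s2 <;> omega
    · rw [hx]; simp

/-- big value at position `q` -/
def bigAt (m k : ℕ) (σ : Equiv.Perm (Fin (m + k))) (q : ℕ) : Prop :=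
  ∃ h : q < m + k, m ≤ (σ ⟨q, h⟩).val

open Classical in
noncomputable def BB (m k : ℕ) (σ : Equiv.Perm (Fin (m + k))) (p : ℕ) : ℕ :=
  Nat.count (bigAt m k σ) p

lemma BB_le (m k : ℕ) (σ : Equiv.Perm (Fin (m + k))) (p : ℕ) : BB m k σ p ≤ k := by
  classical
  unfold BB
  rw [Nat.count_eq_card_filter_range]
  calc _ ≤ (Finset.univ.image (fun w : Fin k => (σ.symm (Fin.natAdd m w)).val)).card := by
        apply Finset.card_le_card
        intro q hq
        simp only [Finset.mem_filter] at hq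
        obtain ⟨-, hq, h1⟩ := hq
        simp only [Finset.mem_image, Finset.mem_univ, true_and]
        rcases small_or_big (σ ⟨q, hq⟩) with ⟨x, hx⟩ | ⟨x, hx⟩
        · rw [hx] at h1; simp at h1; omega
        · exact ⟨x, by rw [← hx]; simp⟩
    _ ≤ _ := Finset.card_image_le.trans (by simp)

lemma BB_lt (m k : ℕ) (σ : Equiv.Perm (Fin (m + k))) {p q : ℕ} (hp : bigAt m k σ p) (hpq : p < q) :
    BB m k σ p < BB m k σ q := by
  classical
  exact Nat.count_strict_mono hp hpq

lemma BB_succ_big (m k : ℕ) (σ : Equiv.Perm (Fin (m + k))) {p : ℕ} (hp : bigAt m k σ p) :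
    BB m k σ (p+1) = BB m k σ p + 1 := by
  simp [BB, Nat.count_succ, hp]

lemma BB_succ_small (m k : ℕ) (σ : Equiv.Perm (Fin (m + k))) {p : ℕ} (hp : ¬ bigAt m k σ p) :
    BB m k σ (p+1) = BB m k σ p := by
  simp [BB, Nat.count_succ, hp]

lemma data_exists {m k : ℕ} (hm : 0 < m) (σ : Equiv.Perm (Fin (m + k))) (hV : Vld m k σ) :
    ∃ (π : Equiv.Perm (Fin k)) (h : Fin m → Fin (k+1) × Bool),
      Nrm h ∧ Img h = Finset.univ ∧ StrictMono (kkey π h ∘ σ) := by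
  classical
  obtain ⟨V1, V2⟩ := hV
  let pb : Fin k → ℕ := fun w => (σ.symm (Fin.natAdd m w)).val
  let ps : Fin m → ℕ := fun v => (σ.symm (Fin.castAdd k v)).val
  have pbl : ∀ w, pb w < m + k := fun w => (σ.symm (Fin.natAdd m w)).isLt
  have psl : ∀ w, ps w < m + k := fun w => (σ.symm (Fin.castAdd k w)).isLt
  have hpb : ∀ w, σ ⟨pb w, pbl w⟩ = Fin.natAdd m w := fun w => by simp [pb]
  have hps : ∀ w, σ ⟨ps w, psl w⟩ = Fin.castAdd k w := fun w => by simp [ps]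
  have pb_eq : ∀ q hq w, σ ⟨q, hq⟩ = Fin.natAdd m w → pb w = q := by
    intro q hq w e; simp [pb, ← e]
  have ps_eq : ∀ q hq w, σ ⟨q, hq⟩ = Fin.castAdd k w → ps w = q := by
    intro q hq w e; simp [ps, ← e]
  have bigpb : ∀ w, bigAt m k σ (pb w) := fun w => ⟨pbl w, by rw [hpb]; simp⟩
  have smallps : ∀ w, ¬ bigAt m k σ (ps w) := by
    rintro w ⟨_, h⟩; rw [hps] at h; simp at h; omega
  -- neighbours of bigs
  have nb : ∀ w, ∃ j, pb w = j + 1 ∧ ∃ h : j + 2 < m + k, 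
      (σ ⟨j, by omega⟩).val < m + w ∧ (σ ⟨j+2, h⟩).val < m + w := by
    intro w
    obtain ⟨j, h, e, h1, h2⟩ := V1 w
    refine ⟨j, pb_eq _ _ _ e, h, ?_, ?_⟩
    · rw [e, Fin.lt_def] at h1; simpa using h1
    · rw [e, Fin.lt_def] at h2; simpa using h2
  -- no two adjacent bigs
  have nadj : ∀ q (hq : q + 1 < m + k) w w', σ ⟨q, by omega⟩ = Fin.natAdd m w →
      σ ⟨q+1, hq⟩ = Fin.natAdd m w' → False := by
    intro q hq w w' e e'
    obtain ⟨j, hj, h, h1, h2⟩ := nb w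
    obtain ⟨j', hj', h', h1', h2'⟩ := nb w'
    have a1 := pb_eq _ _ _ e
    have a2 := pb_eq _ _ _ e'
    have c1 : j + 2 = q + 1 := by omega
    have c2 : j' = q := by omega
    subst c2
    simp only [c1] at h2
    rw [e'] at h2
    rw [e] at h1'
    simp at h2 h1'
    omega
  let π0 : Fin k → Fin k := fun w => ⟨BB m k σ (pb w), by
    have := BB_lt m k σ (bigpb w) (Nat.lt_succ_self _)
    have := BB_le m k σ (pb w).succ
    omega⟩
  have π0inj : Function.Injective π0 := by
    intro w w' e
    have e : BB m k σ (pb w) = BB m k σ (pb w') := congrArg Fin.val e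
    have : pb w = pb w' := by
      rcases lt_trichotomy (pb w) (pb w') with hl | hl | hl
      · have := BB_lt m k σ (bigpb w) hl; omega
      · exact hl
      · have := BB_lt m k σ (bigpb w') hl; omega
    have := hpb w
    simp only [‹pb w = pb w'›] at this
    rw [hpb] at this
    simpa using this.symm
  let π : Equiv.Perm (Fin k) := Equiv.ofBijective π0 (Finite.injective_iff_bijective.1 π0inj)
  have hπ : ∀ w, (π w).val = BB m k σ (pb w) := fun w => rfl
  let h : Fin m → Fin (k+1) × Bool := fun v =>
    (⟨BB m k σ (ps v), Nat.lt_succ_of_le (BB_le m k σ _)⟩,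
      decide (∃ q, ∃ hq : q + 1 < m + k, q + 1 = ps v ∧ (σ ⟨q, by omega⟩).val < v.val))
  have hh1 : ∀ v, (h v).1.val = BB m k σ (ps v) := fun v => rfl
  have hh2 : ∀ v, (h v).2 = true ↔
    (∃ q, ∃ hq : q + 1 < m + k, q + 1 = ps v ∧ (σ ⟨q, by omega⟩).val < v.val) :=
    fun v => by simp [h]
  refine ⟨π, h, ?_, ?_, ?_⟩
  · intro v hv
    obtain ⟨q, hq, e, hl⟩ := (hh2 v).1 hv
    rcases small_or_big (σ ⟨q, by omega⟩) with ⟨x, hx⟩ | ⟨x, hx⟩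
    · rw [hx] at hl
      refine ⟨x, by simpa using hl, ?_⟩
      apply Fin.ext
      rw [hh1, hh1, ← e, ← ps_eq _ _ _ hx, BB_succ_small _ _ _ (smallps x)]
    · rw [hx] at hl; simp at hl; omega
  · rw [Finset.eq_univ_iff_forall]
    intro b
    simp only [Img, Finset.mem_image, Finset.mem_univ, true_and]
    induction b using Fin.cases with
    | zero =>
      rcases small_or_big (σ ⟨0, by omega⟩) with ⟨x, hx⟩ | ⟨x, hx⟩
      · refine ⟨x, Fin.ext ?_⟩
        rw [hh1, ps_eq _ _ _ hx]; simp [BB]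
      · obtain ⟨j, hj, _⟩ := nb x
        have := pb_eq _ _ _ hx
        omega
    | succ c =>
      obtain ⟨w, rfl⟩ := π.surjective c
      obtain ⟨j, hj, hj2, _⟩ := nb w
      rcases small_or_big (σ ⟨j+1+1, hj2⟩) with ⟨x, hx⟩ | ⟨x, hx⟩
      · refine ⟨x, Fin.ext ?_⟩
        rw [hh1, ps_eq _ _ _ hx, ← hj, BB_succ_big _ _ _ (bigpb w)]
        simp [hπ]
      · exfalso
        refine nadj (j+1) hj2 w x ?_ hx
        simp only [← hj]
        exact hpb w
  · have main : ∀ q (hq : q + 1 < m + k), kkey π h (σ ⟨q, by omega⟩) < kkey π h (σ ⟨q+1, hq⟩) := by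
      intro q hq
      rcases small_or_big (σ ⟨q, by omega⟩) with ⟨x, hx⟩ | ⟨x, hx⟩
      · have ex := ps_eq _ _ _ hx
        rcases small_or_big (σ ⟨q+1, hq⟩) with ⟨y, hy⟩ | ⟨y, hy⟩
        · have ey := ps_eq _ _ _ hy
          rw [hx, hy, small_lt_small]
          right
          refine ⟨?_, ?_⟩
          · apply Fin.ext
            rw [hh1, hh1, ey, ← ex, BB_succ_small _ _ _ (smallps x)]
          · rcases lt_trichotomy x y with hl | hl | hl
            · right; left
              refine ⟨hl, (hh2 y).2 ⟨q, hq, ey.symm, ?_⟩⟩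
              rw [hx]; simpa using hl
            · exfalso
              rw [hl] at ex; omega
            · right; right
              refine ⟨hl, ?_⟩
              rw [Bool.eq_false_iff]
              intro hc
              obtain ⟨r, hr, e, hrl⟩ := (hh2 x).1 hc
              have : q = r + 1 := by omega
              subst this
              have := V2 r hq (by rw [hx, Fin.lt_def]; simpa using hrl)
                (by rw [hx]; rw [hy, Fin.lt_def]; simpa using hl)
              rw [hx] at this
              simp at this
              omega
        · have ey := pb_eq _ _ _ hy
          rw [hx, hy, small_lt_big, hh1, hπ, ey, ← ex, BB_succ_small _ _ _ (smallps x)]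
      · have ex := pb_eq _ _ _ hx
        rcases small_or_big (σ ⟨q+1, hq⟩) with ⟨y, hy⟩ | ⟨y, hy⟩
        · have ey := ps_eq _ _ _ hy
          rw [hx, hy, big_lt_small, hh1, hπ, ey, ← ex, BB_succ_big _ _ _ (bigpb x)]
          omega
        · exact (nadj q hq x y hx hy).elim
    have main2 : ∀ d q (hq : q + d + 1 < m + k),
        kkey π h (σ ⟨q, by omega⟩) < kkey π h (σ ⟨q+d+1, hq⟩) := by
      intro d
      induction d with
      | zero => intro q hq; exact main q hq
      | succ d ih => intro q hq; exact (ih q (by omega)).trans (main (q+d+1) hq)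
    rintro ⟨p, hp⟩ ⟨q, hq⟩ hpq
    rw [Fin.lt_def] at hpq
    simp only at hpq
    obtain ⟨d, rfl⟩ : ∃ d, q = p + d + 1 := ⟨q - p - 1, by omega⟩
    exact main2 d p hq

open Classical in
lemma cp_eq (m k : ℕ) (hm : 0 < m) :
    cp (m + k) (Finset.Icc (m + 1) (m + k)) = k.factorial * cCnt m (k+1) := by
  have e1 : k.factorial * cCnt m (k+1) = ((Finset.univ : Finset (Equiv.Perm (Fin k))) ×ˢ
      (Finset.univ.filter (fun h : Fin m → Fin (k+1) × Bool =>
        Nrm h ∧ Img h = Finset.univ))).card := by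
    rw [Finset.card_product, Finset.card_univ, Fintype.card_perm, Fintype.card_fin]
    congr 1
    have := GG_eq (k+1) m Finset.univ
    rw [Finset.card_univ, Fintype.card_fin] at this
    rw [← this]
    rfl
  rw [e1, cp]
  symm
  refine Finset.card_bij (fun d _ => (sort_exists d.1 d.2).choose) ?_ ?_ ?_
  · rintro ⟨π, h⟩ hd
    simp only [Finset.mem_product, Finset.mem_filter, Finset.mem_univ, true_and] at hd
    simp only [CPperms, Finset.mem_filter, Finset.mem_univ, true_and]
    rw [vld_iff]
    exact sort_valid (sort_exists π h).choose_spec hd.2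
  · rintro ⟨π, h⟩ hd ⟨π', h'⟩ hd' e
    simp only [Finset.mem_product, Finset.mem_filter, Finset.mem_univ, true_and] at hd hd'
    have s1 := (sort_exists π h).choose_spec
    have s2 := (sort_exists π' h').choose_spec
    simp only at e
    rw [e] at s1
    obtain ⟨rfl, rfl⟩ := data_unique s1 s2 hd.1 hd'.1
    rfl
  · intro σ hσ
    simp only [CPperms, Finset.mem_filter, Finset.mem_univ, true_and] at hσ
    rw [vld_iff] at hσ
    obtain ⟨π, h, hN, hS, hs⟩ := data_exists hm σ hσ
    refine ⟨(π, h), by simp [hN, hS], ?_⟩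
    have s1 := (sort_exists π h).choose_spec
    simp only
    generalize (sort_exists π h).choose = τ at s1
    have hr : Set.range (kkey π h ∘ τ) = Set.range (kkey π h ∘ σ) := by
      rw [τ.surjective.range_comp, σ.surjective.range_comp]
    have := (StrictMono.range_inj s1 hs).1 hr
    ext x
    have := congrFun this x
    exact congrArg Fin.val (kkey_inj π h this)

theorem cp_top_interval_formula_a (a : ℕ → ℕ → ℚ) (ha0 : a 0 0 = 1 / 2)
    (harec1 : ∀ k, ∀ i, 1 ≤ i → i ≤ k + 1 →
      a (k + 1) i = ((k : ℚ) + 1) * ((k : ℚ) + 2) * (((k : ℚ) + 2 - (i : ℚ)) / (i : ℚ)) *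
        a k (i - 1))
    (harec0 : ∀ k, a (k + 1) 0 = ∑ j ∈ Finset.Icc 1 (k + 1), (-1) ^ (j + 1) * a (k + 1) j) :
    ∀ k n : ℕ, max 3 (2 * k) ≤ n →
      (CPperms n (Finset.Icc (n - k + 1) n)).Nonempty →
      (cp n (Finset.Icc (n - k + 1) n) : ℚ) =
        ∑ i ∈ Finset.range (k + 1), (-1) ^ i * a k i *
          (2 * (k : ℚ) + 2 - 2 * (i : ℚ)) ^ (n - 2 * k) := by
  intro k n hn _
  have h3 : 3 ≤ n := le_trans (le_max_left _ _) hn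
  have h2 : 2 * k ≤ n := le_trans (le_max_right _ _) hn
  obtain ⟨t, rfl⟩ : ∃ t, n = k + t + k := ⟨n - 2 * k, by omega⟩
  have e1 : k + t + k - k = k + t := by omega
  have e2 : k + t + k - 2 * k = t := by omega
  rw [e1, e2, cp_eq (k + t) k (by omega)]
  exact algebra_part a ha0 harec1 harec0 k t (by omega)
end

section
/- Let i ≥ 0, and let r, n, k be nonnegative integers with n − r − 2k ≥ 0. Then the total weight of all circular-peak paths from (r,0) to (n,k) satisfies w(i,r,n,k) = Σ_{P ∈ P_{r,n,k}} w_i(P) = 2^{n−r−2k} · ∏_{m=0}^{k−1} (m+i+1)(m+i+2) · Σ ∏_{m=0}^{k} (i+m+1)^{t_m}, where the last sum is over all (k+1)-tuples (t_0, t_1, ..., t_k) of nonnegative integers with t_0 + t_1 + ... + t_k = n − r − 2k. -/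
/-- The weight `w_i(P)` of a circular-peak path, encoded as a word over
`Bool` (`false` = horizontal step `H`, `true` = rise step `R`), read from a
starting height `y`: an `H`-step at height `y` weighs `2i + 2(y+1)`, an
`R`-step at height `y` weighs `(y+i+1)(y+i+2)`. -/
def pathWeight (i : ℕ) : ℕ → List Bool → ℕ
  | _, [] => 1
  | y, false :: rest => (2 * i + 2 * (y + 1)) * pathWeight i y rest
  | y, true :: rest => (y + i + 1) * (y + i + 2) * pathWeight i (y + 1) rest

def pwW (i N k : ℕ) : ℕ :=
  ∑ P : Fin N → Bool, if (List.ofFn P).count true = k then pathWeight i 0 (List.ofFn P) else 0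

def pwS (i k s : ℕ) : ℕ :=
  ∑ t ∈ Finset.Nat.antidiagonalTuple k s, ∏ m : Fin k, (i + (m : ℕ) + 1) ^ t m

theorem pathWeight_shift (i : ℕ) (l : List Bool) :
    ∀ y, pathWeight i (y + 1) l = pathWeight (i + 1) y l := by
  induction l with
  | nil => intro y; simp [pathWeight]
  | cons b l ih =>
    intro y
    cases b <;> simp only [pathWeight, ih] <;> ring

theorem pwW_succ (i N k : ℕ) : pwW i (N + 1) k =
    2 * (i + 1) * pwW i N k +
      (∑ P : Fin N → Bool, if (List.ofFn P).count true + 1 = k then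
        (i + 1) * (i + 2) * pathWeight (i + 1) 0 (List.ofFn P) else 0) := by
  unfold pwW
  rw [← (Fin.consEquiv (fun _ : Fin (N + 1) => Bool)).sum_comp, Fintype.sum_prod_type,
    Fintype.sum_bool, add_comm]
  congr 1
  · rw [Finset.mul_sum]
    refine Finset.sum_congr rfl fun P _ => ?_
    simp [Fin.consEquiv, List.ofFn_succ, pathWeight]
    rw [show 2 * i + 2 = 2 * (i + 1) by ring]
  · refine Finset.sum_congr rfl fun P _ => ?_
    simp [Fin.consEquiv, List.ofFn_succ, pathWeight, ← pathWeight_shift]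

theorem pwW_succ_zero (i N : ℕ) : pwW i (N + 1) 0 = 2 * (i + 1) * pwW i N 0 := by
  rw [pwW_succ]; simp

theorem pwW_succ_succ (i N k : ℕ) : pwW i (N + 1) (k + 1) =
    2 * (i + 1) * pwW i N (k + 1) + (i + 1) * (i + 2) * pwW (i + 1) N k := by
  rw [pwW_succ]; simp [pwW, Finset.mul_sum]

theorem pwW_zero (i k : ℕ) : pwW i 0 k = if k = 0 then 1 else 0 := by
  simp [pwW, pathWeight, eq_comm]

theorem pwW_lt (N : ℕ) : ∀ i k, N < k → pwW i N k = 0 := by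
  intro i k h
  unfold pwW
  refine Finset.sum_eq_zero fun P _ => ?_
  have := List.count_le_length (a := true) (l := List.ofFn P)
  rw [List.length_ofFn] at this
  rw [if_neg (by omega)]

theorem pwS_step (i k s : ℕ) : pwS i (k + 1) s =
    ∑ p ∈ Finset.HasAntidiagonal.antidiagonal s, (i + 1) ^ p.1 * pwS (i + 1) k p.2 := by
  unfold pwS
  simp only [Finset.mul_sum]
  rw [Finset.sum_sigma']
  refine Finset.sum_bij' (fun t _ => ⟨(t 0, ∑ j, Fin.tail t j), Fin.tail t⟩)
    (fun p _ => Fin.cons p.1.1 p.2) ?_ ?_ ?_ ?_ ?_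
  · intro t ht
    rw [Finset.Nat.mem_antidiagonalTuple, Fin.sum_univ_succ] at ht
    simp [Finset.Nat.mem_antidiagonalTuple, Fin.tail, ht]
  · rintro ⟨⟨a, b⟩, u⟩ hp
    simp [Finset.Nat.mem_antidiagonalTuple] at hp
    simp [Finset.Nat.mem_antidiagonalTuple, Fin.sum_univ_succ, hp]
  · intro t _
    simp
  · rintro ⟨⟨a, b⟩, u⟩ hp
    simp [Finset.Nat.mem_antidiagonalTuple] at hp
    simp [hp]
  · intro t _
    rw [Fin.prod_univ_succ]
    simp only [Fin.val_zero, Fin.val_succ, Fin.tail, add_zero]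
    congr 1
    exact Finset.prod_congr rfl fun m _ => by ring

theorem pwS_succ (i k s : ℕ) : pwS i (k + 1) (s + 1) =
    (i + 1) * pwS i (k + 1) s + pwS (i + 1) k (s + 1) := by
  rw [pwS_step, pwS_step, Finset.Nat.antidiagonal_succ]
  simp [Finset.mul_sum, pow_succ]
  rw [add_comm]
  congr 1
  refine Finset.sum_congr rfl fun P _ => ?_
  ring

theorem pwS_zero (i k : ℕ) : pwS i k 0 = 1 := by
  simp [pwS, Finset.Nat.antidiagonalTuple_zero_right]

theorem pwS_zero' (i s : ℕ) : pwS i 0 (s + 1) = 0 := by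
  simp [pwS]

theorem pw_main (N : ℕ) : ∀ i k s, N = k + s → pwW i N k =
    2 ^ s * (∏ m ∈ Finset.range k, (m + i + 1) * (m + i + 2)) * pwS i (k + 1) s := by
  induction N with
  | zero =>
    intro i k s h
    obtain ⟨rfl, rfl⟩ : k = 0 ∧ s = 0 := by omega
    simp [pwW_zero, pwS_zero]
  | succ N ih =>
    intro i k s h
    have hp : ∀ k, (∏ m ∈ Finset.range (k + 1), (m + i + 1) * (m + i + 2)) =
        (i + 1) * (i + 2) * ∏ m ∈ Finset.range k, (m + (i + 1) + 1) * (m + (i + 1) + 2) := by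
      intro k
      rw [Finset.prod_range_succ', mul_comm]
      congr 1
      · ring
      · exact Finset.prod_congr rfl fun m _ => by ring
    rcases k with _ | k
    · obtain rfl : s = N + 1 := by omega
      rw [pwW_succ_zero, ih i 0 N (by omega), pwS_succ, pwS_zero']
      simp; ring
    · rw [pwW_succ_succ, ih (i + 1) k s (by omega), hp]
      rcases s with _ | s
      · rw [pwW_lt _ _ _ (by omega)]
        simp [pwS_zero]
      · rw [ih i (k + 1) s (by omega), hp, pwS_succ i (k + 1) s]
        ring

theorem pathWeight_sum_formula (i r n k : ℕ) (h : r + 2 * k ≤ n) :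
    ∑ P ∈ Finset.univ.filter
        (fun P : Fin (n - k - r) → Bool => (List.ofFn P).count true = k),
      pathWeight i 0 (List.ofFn P) =
    2 ^ (n - r - 2 * k) * (∏ m ∈ Finset.range k, (m + i + 1) * (m + i + 2)) *
      ∑ t ∈ Finset.Nat.antidiagonalTuple (k + 1) (n - r - 2 * k),
        ∏ m : Fin (k + 1), (i + (m : ℕ) + 1) ^ t m := by
  rw [Finset.sum_filter]
  exact pw_main (n - k - r) i k (n - r - 2 * k) (by omega)
end
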